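/- arXiv:2507.08483 — 6 statements merged into one kernel-verified Lean document; each statement's English description precedes it below -/
import Mathlib

section
/- A finite simple graph G is word-representable if and only if G admits a semi-transitive orientation. -/
/-- Two distinct letters `x` and `y` alternate in a word `w` if the subsequence of `w`
obtained by deleting all letters other than `x` and `y` has no two equal consecutive
letters (i.e. it is of the form `xyxy...` or `yxyx...`). -/
def Alternates {V : Type*} [DecidableEq V] (w : List V) (x y : V) : Prop :=
  (w.filter fun z => decide (z = x ∨ z = y)).Chain' (· ≠ ·)

/-- `w` is a word representing the graph `G`: every vertex occurs in `w`, and two distinct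
vertices alternate in `w` iff they are adjacent in `G`. -/
def WordRepresents {V : Type*} [DecidableEq V] (G : SimpleGraph V) (w : List V) : Prop :=
  (∀ v : V, v ∈ w) ∧ ∀ x y : V, x ≠ y → (Alternates w x y ↔ G.Adj x y)

/-- A graph is word-representable if some word represents it. -/
def WordRepresentable {V : Type*} [DecidableEq V] (G : SimpleGraph V) : Prop :=
  ∃ w : List V, WordRepresents G w
/-- `r` is an orientation of `G`: an irreflexive, asymmetric relation (exactly one direction
per edge) whose symmetric closure is the adjacency relation of `G`. -/
structure IsOrientation {V : Type*} (G : SimpleGraph V) (r : V → V → Prop) : Prop where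
  irrefl : ∀ v, ¬ r v v
  asymm : ∀ u v, r u v → ¬ r v u
  adj_iff : ∀ u v, G.Adj u v ↔ (r u v ∨ r v u)

/-- A relation is acyclic if it has no directed cycle. -/
def RelAcyclic {V : Type*} (r : V → V → Prop) : Prop :=
  ∀ v, ¬ Relation.TransGen r v v

/-- `r` is a semi-transitive orientation of `G`: it is an acyclic orientation and for any
directed path `p 0 → p 1 → ⋯ → p t` (with `t ≥ 1` edges, i.e. at least two vertices),
either there is no edge between the endpoints, or `p i → p j` for all `i < j`. -/
def IsSemiTransitiveOrientation {V : Type*} (G : SimpleGraph V) (r : V → V → Prop) : Prop :=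
  IsOrientation G r ∧ RelAcyclic r ∧
    ∀ (t : ℕ) (p : Fin (t + 1) → V), 1 ≤ t →
      (∀ i : Fin t, r (p i.castSucc) (p i.succ)) →
      (¬ G.Adj (p 0) (p (Fin.last t)) ∨ ∀ i j : Fin (t + 1), i < j → r (p i) (p j))

section Words

variable {V : Type*} [DecidableEq V]

/-- The subsequence of `w` formed by the letters `x` and `y`. -/
def restrictPair (w : List V) (x y : V) : List V :=
  w.filter fun z => decide (z = x ∨ z = y)

lemma restrictPair_comm (w : List V) (x y : V) : restrictPair w x y = restrictPair w y x := by
  simp only [restrictPair, or_comm]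

lemma restrictPair_append (v w : List V) (x y : V) :
    restrictPair (v ++ w) x y = restrictPair v x y ++ restrictPair w x y :=
  List.filter_append ..

lemma alternates_comm {w : List V} {x y : V} : Alternates w x y ↔ Alternates w y x := by
  simp only [Alternates, or_comm]

lemma Alternates.of_infix {v w : List V} {x y : V} (h : Alternates w x y) (hv : v <:+: w) :
    Alternates v x y :=
  List.IsChain.infix h (hv.filter _)

/-- In every prefix of `w`, the letter `x` occurs as often as `y` or once more. -/
def Leads (w : List V) (x y : V) : Prop :=
  ∀ p, p <+: w → p.count y ≤ p.count x ∧ p.count x ≤ p.count y + 1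

lemma isChain_cons_restrictPair_iff_leads {w : List V} {x y : V} (hxy : x ≠ y) :
    (y :: restrictPair w x y).IsChain (· ≠ ·) ↔ Leads w x y := by
  induction w generalizing x y with
  | nil => simp [restrictPair, Leads]
  | cons a w ih =>
    have key : Leads (a :: w) x y ↔ ∀ p, p <+: w →
        (a :: p).count y ≤ (a :: p).count x ∧ (a :: p).count x ≤ (a :: p).count y + 1 := by
      constructor
      · intro h p hp
        exact h _ (List.cons_prefix_cons.2 ⟨rfl, hp⟩)
      · intro h p hp
        rcases List.prefix_cons_iff.1 hp with rfl | ⟨t, rfl, ht⟩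
        · simp
        · exact h t ht
    rw [key]
    by_cases hx : a = x
    · subst hx
      have : restrictPair (a :: w) a y = a :: restrictPair w y a := by
        rw [restrictPair_comm w]; simp [restrictPair]
      rw [this, List.isChain_cons_cons, ih hxy.symm]
      simp only [ne_eq, hxy.symm, not_false_eq_true, true_and, Leads, List.count_cons_self,
        List.count_cons_of_ne hxy]
      exact forall₂_congr fun p _ => by omega
    · by_cases hy : a = y
      · subst hy
        have : restrictPair (a :: w) x a = a :: restrictPair w x a := by simp [restrictPair]
        rw [this, List.isChain_cons_cons]
        refine ⟨fun h => absurd rfl h.1, fun h => ?_⟩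
        have := h [] List.nil_prefix
        simp [hxy.symm] at this
      · have : restrictPair (a :: w) x y = restrictPair w x y := by simp [restrictPair, hx, hy]
        rw [this, ih hxy]
        simp only [Leads, List.count_cons_of_ne hx, List.count_cons_of_ne hy]

lemma alternates_iff_leads_or_leads {w : List V} {x y : V} (hxy : x ≠ y) :
    Alternates w x y ↔ Leads w x y ∨ Leads w y x := by
  rw [← isChain_cons_restrictPair_iff_leads hxy, ← isChain_cons_restrictPair_iff_leads hxy.symm,
    restrictPair_comm w y x]
  change (restrictPair w x y).IsChain (· ≠ ·) ↔ _
  have hmem : ∀ z ∈ restrictPair w x y, z = x ∨ z = y := fun z hz => by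
    simpa using (List.mem_filter.1 hz).2
  cases h : restrictPair w x y with
  | nil => simp
  | cons a l =>
    simp only [List.isChain_cons_cons]
    rcases hmem a (by simp [h]) with rfl | rfl
    · simp [hxy.symm]
    · simp [hxy]

lemma Leads.not_swap {w : List V} {x y : V} (hx : x ∈ w) (hxy : x ≠ y) (h : Leads w x y) :
    ¬ Leads w y x := by
  intro h'
  obtain ⟨s, t, rfl⟩ := List.append_of_mem hx
  have h₁ := h s (List.prefix_append ..)
  have h₂ := h' s (List.prefix_append ..)
  have h₃ := h' (s ++ [x]) ⟨t, by simp⟩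
  simp only [List.count_append, List.count_singleton_self, List.count_singleton, beq_iff_eq,
    hxy, if_false] at h₃
  omega

/-- A word representing a graph yields the orientation from leading to following letters. -/
lemma WordRepresents.isSemiTransitiveOrientation {G : SimpleGraph V} {w : List V}
    (hw : WordRepresents G w) :
    IsSemiTransitiveOrientation G fun x y => x ≠ y ∧ Leads w x y := by
  obtain ⟨hmem, hadj⟩ := hw
  refine ⟨⟨fun v h => h.1 rfl, fun u v h h' => h.2.not_swap (hmem u) h.1 h'.2, fun u v => ?_⟩,
    fun v hv => ?_, fun t p _ hp => ?_⟩
  · by_cases huv : u = v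
    · simp [huv]
    · rw [← hadj u v huv, alternates_iff_leads_or_leads huv]
      simp [huv, Ne.symm huv]
  · have count_le : ∀ a b, Relation.ReflTransGen (fun x y => x ≠ y ∧ Leads w x y) a b →
        ∀ q, q <+: w → q.count b ≤ q.count a := by
      intro a b hab q hq
      induction hab with
      | refl => exact le_rfl
      | tail _ hbc ih => exact (hbc.2 q hq).1.trans ih
    obtain ⟨u, hvu, huv⟩ := Relation.TransGen.head'_iff.1 hv
    refine hvu.2.not_swap (hmem v) hvu.1 fun q hq => ⟨count_le _ _ huv q hq, ?_⟩
    exact (hvu.2 q hq).1.trans (Nat.le_succ _)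
  · rw [or_iff_not_imp_left, not_not]
    intro hends
    have anti : ∀ q, q <+: w → Antitone fun i => q.count (p i) := fun q hq =>
      Fin.antitone_iff_succ_le.2 fun i => ((hp i).2 q hq).1
    have hne : p 0 ≠ p (Fin.last t) := hends.ne
    have hlead : Leads w (p 0) (p (Fin.last t)) := by
      rcases (alternates_iff_leads_or_leads hne).1 ((hadj _ _ hne).2 hends) with h | h
      · exact h
      · intro q hq
        have h₁ := anti q hq (Fin.zero_le (Fin.last t))
        have h₂ := h q hq
        simp only at h₁
        omega
    have strict : ∀ i j : Fin (t + 1), i < j → p i ≠ p j := by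
      intro i j hij heq
      have hi : (i : ℕ) < t := by have := j.isLt; have : (i : ℕ) < j := hij; omega
      have hstep := hp ⟨i, hi⟩
      have hi' : (⟨i, hi⟩ : Fin t).castSucc = i := rfl
      rw [hi'] at hstep
      refine hstep.2.not_swap (hmem _) hstep.1 fun q hq => ⟨?_, ?_⟩
      · have : q.count (p j) ≤ q.count (p (⟨i, hi⟩ : Fin t).succ) :=
          anti q hq (Fin.le_def.2 (by simpa using hij))
        rwa [← heq] at this
      · exact ((hstep.2 q hq).1).trans (Nat.le_succ _)
    intro i j hij
    refine ⟨strict i j hij, fun q hq => ⟨anti q hq hij.le, ?_⟩⟩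
    have h₁ := anti q hq (Fin.zero_le i)
    have h₂ := anti q hq (Fin.le_last j)
    have h₃ := (hlead q hq).2
    simp only at h₁ h₂
    omega

end Words

section Relations

variable {V : Type*} {r : V → V → Prop}

/-- A topological sort of an acyclic relation on a finite type. -/
lemma RelAcyclic.exists_topologicalSort [Fintype V] (hr : RelAcyclic r) :
    ∃ T : List V, T.Nodup ∧ (∀ v, v ∈ T) ∧ T.Pairwise fun a b => ¬ r b a := by
  let le : V → V → Prop := Relation.ReflTransGen r
  have : IsPartialOrder V le :=
    { refl := fun _ => .refl
      trans := fun _ _ _ => .trans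
      antisymm := fun a b hab hba => by
        rcases Relation.reflTransGen_iff_eq_or_transGen.1 hab with h | h
        · exact h.symm
        · exact absurd (h.trans_left hba) (hr a) }
  obtain ⟨s, hs, hle⟩ := extend_partialOrder le
  classical
  refine ⟨Finset.univ.sort s, Finset.sort_nodup .., by simp, ?_⟩
  have hsort : (Finset.univ.sort s).Pairwise s := Finset.pairwise_sort ..
  refine (hsort.and (Finset.sort_nodup Finset.univ s)).imp ?_
  rintro a b ⟨hab, hne⟩ hba
  exact hne (hs.antisymm _ _ hab (hle _ _ (.single hba)))

lemma exists_path_of_reflTransGen {a b : V} (h : Relation.ReflTransGen r a b) :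
    ∃ (t : ℕ) (p : ℕ → V), p 0 = a ∧ p t = b ∧ ∀ i < t, r (p i) (p (i + 1)) := by
  induction h with
  | refl => exact ⟨0, fun _ => a, rfl, rfl, by simp⟩
  | @tail b c _ hbc ih =>
    obtain ⟨t, p, h0, ht, hp⟩ := ih
    refine ⟨t + 1, fun i => if i ≤ t then p i else c, by simpa using h0, by simp, fun i hi => ?_⟩
    rcases Nat.lt_succ_iff_lt_or_eq.1 hi with hi | rfl
    · have : i + 1 ≤ t := hi
      simpa [hi.le, this] using hp i hi
    · simpa [ht] using hbc

lemma exists_path_append {t u : ℕ} {p q : ℕ → V} (hpq : p t = q 0)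
    (hp : ∀ i < t, r (p i) (p (i + 1))) (hq : ∀ i < u, r (q i) (q (i + 1))) :
    ∃ f : ℕ → V, (∀ i ≤ t, f i = p i) ∧ (∀ i, f (t + i) = q i) ∧
      ∀ i < t + u, r (f i) (f (i + 1)) := by
  have hf : ∀ i, (if t + i ≤ t then p (t + i) else q (t + i - t)) = q i := by
    intro i
    rcases Nat.eq_zero_or_pos i with rfl | hi
    · simpa using hpq
    · simp [hi.ne']
  refine ⟨fun i => if i ≤ t then p i else q (i - t), fun i hi => by simp [hi], hf, fun i hi => ?_⟩
  rcases Nat.lt_or_ge i t with hit | hit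
  · have : i + 1 ≤ t := hit
    simpa [hit.le, this] using hp i hit
  · obtain ⟨j, rfl⟩ := Nat.exists_eq_add_of_le hit
    have := hq j (by omega)
    rw [← hf j, ← hf (j + 1)] at this
    exact this

/-- In a semi-transitive orientation, two vertices on a directed path bridged by an arrow
are joined by an arrow. -/
lemma IsSemiTransitiveOrientation.rel_of_bridge {G : SimpleGraph V}
    (h : IsSemiTransitiveOrientation G r) {a x y b : V} (hax : Relation.ReflTransGen r a x)
    (hxy : Relation.ReflTransGen r x y) (hyb : Relation.ReflTransGen r y b) (hab : r a b)
    (hne : x ≠ y) : r x y := by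
  obtain ⟨l, p, p0, pl, hp⟩ := exists_path_of_reflTransGen hax
  obtain ⟨m, q, q0, qm, hq⟩ := exists_path_of_reflTransGen hxy
  obtain ⟨n, s, s0, sn, hs⟩ := exists_path_of_reflTransGen hyb
  obtain ⟨f, f₁, f₂, hf⟩ := exists_path_append (pl.trans q0.symm) hp hq
  obtain ⟨g, g₁, g₂, hg⟩ := exists_path_append (p := f) (t := l + m)
    ((f₂ m).trans (qm.trans s0.symm)) hf hs
  have hm : 0 < m := Nat.pos_of_ne_zero fun e => hne (by rw [← q0, ← qm, e])
  rcases h.2.2 (l + m + n) (fun i => g i) (by omega) (fun i => hg i i.isLt) with h' | h'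
  · refine absurd ((h.1.adj_iff _ _).2 (Or.inl ?_)) h'
    have e : g 0 = a := by rw [g₁ 0 (by omega), f₁ 0 (by omega), p0]
    simpa [e, g₂, sn] using hab
  · have := h' ⟨l, by omega⟩ ⟨l + m, by omega⟩ (Fin.lt_def.2 (by simpa using hm))
    have e₁ : g l = x := by rw [g₁ l (by omega), f₁ l le_rfl, pl]
    have e₂ : g (l + m) = y := by rw [g₁ _ le_rfl, f₂, qm]
    simpa [e₁, e₂] using this

end Relations

section Construction

variable {V : Type*} [DecidableEq V] {r : V → V → Prop}

/-- Restricted to the ends of any arrow `a → b`, the word `w` reads `abab⋯ab`. -/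
def Follows (r : V → V → Prop) (w : List V) : Prop :=
  ∀ a b, r a b → ∃ k, restrictPair w a b = (List.replicate k [a, b]).flatten

lemma Follows.append {v w : List V} (hv : Follows r v) (hw : Follows r w) :
    Follows r (v ++ w) := by
  intro a b hab
  obtain ⟨k, hk⟩ := hv a b hab
  obtain ⟨l, hl⟩ := hw a b hab
  exact ⟨k + l, by rw [restrictPair_append, hk, hl, List.replicate_add, List.flatten_append]⟩

lemma Follows.flatten {L : List (List V)} (h : ∀ w ∈ L, Follows r w) : Follows r L.flatten := by
  induction L with
  | nil => exact fun a b _ => ⟨0, rfl⟩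
  | cons w L ih =>
    exact (h w (by simp)).append (ih fun v hv => h v (List.mem_cons_of_mem _ hv))

lemma Follows.alternates {w : List V} (h : Follows r w) {a b : V} (hab : r a b) (hne : a ≠ b) :
    Alternates w a b := by
  obtain ⟨k, hk⟩ := h a b hab
  have chain : ∀ k, (b :: (List.replicate k [a, b]).flatten).IsChain (· ≠ ·) := by
    intro k
    induction k with
    | zero => simp
    | succ k ih =>
      rw [List.replicate_succ, List.flatten_cons]
      exact List.isChain_cons_cons.2 ⟨hne.symm, List.isChain_cons_cons.2 ⟨hne, ih⟩⟩
  change (restrictPair w a b).IsChain (· ≠ ·)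
  rw [hk]
  exact (chain k).tail

lemma restrictPair_eq_or {T : List V} (hnd : T.Nodup) (hT : ∀ v, v ∈ T) {x y : V} (hxy : x ≠ y) :
    restrictPair T x y = [x, y] ∨ restrictPair T x y = [y, x] := by
  have hp : (restrictPair T x y).Perm [x, y] := by
    refine (List.perm_ext_iff_of_nodup (hnd.filter _) (by simpa using hxy)).2 fun z => ?_
    simp [hT]
  rcases h : restrictPair T x y with _ | ⟨a, _ | ⟨b, _ | ⟨c, l⟩⟩⟩ <;> rw [h] at hp
  · simpa using hp.length_eq
  · simpa using hp.length_eq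
  · have ha : a = x ∨ a = y := by simpa using hp.subset (List.mem_cons_self)
    have hb : b = x ∨ b = y := by
      simpa using hp.subset (List.mem_cons_of_mem a (List.mem_cons_self))
    have hab : a ≠ b := by simpa using hp.nodup_iff.2 (by simpa using hxy)
    grind
  · simpa using hp.length_eq

lemma restrictPair_eq_of_rel {T : List V} (hnd : T.Nodup) (hT : ∀ v, v ∈ T)
    (hs : T.Pairwise fun a b => ¬ r b a) {a b : V} (hab : r a b) (hne : a ≠ b) :
    restrictPair T a b = [a, b] := by
  rcases restrictPair_eq_or hnd hT hne with h | h
  · exact h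
  · have : (restrictPair T a b).Pairwise fun a b => ¬ r b a := hs.sublist List.filter_sublist
    simp [h, hab] at this

lemma restrictPair_filter (T : List V) (q : V → Bool) (x y : V) :
    restrictPair (T.filter q) x y = (restrictPair T x y).filter q :=
  List.filter_comm ..

/-- The word `S₁S₀`, where `S₁`, `S₀` are the topologically sorted sets of vertices
that the vertex `y` does not reach and reaches, respectively. -/
lemma exists_follows_of_not_reaches {T : List V} (hnd : T.Nodup) (hT : ∀ v, v ∈ T)
    (hs : T.Pairwise fun a b => ¬ r b a) (hirr : ∀ v, ¬ r v v) {x y : V} (hxy : x ≠ y)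
    (h : ¬ Relation.ReflTransGen r y x) :
    ∃ w, Follows r w ∧ restrictPair w x y = [x, y] := by
  classical
  refine ⟨T.filter (fun u => ¬ Relation.ReflTransGen r y u) ++
    T.filter (fun u => Relation.ReflTransGen r y u), fun a b hab => ⟨1, ?_⟩, ?_⟩
  · have hne : a ≠ b := fun e => hirr b (e ▸ hab)
    rw [restrictPair_append, restrictPair_filter, restrictPair_filter,
      restrictPair_eq_of_rel hnd hT hs hab hne]
    have : Relation.ReflTransGen r y a → Relation.ReflTransGen r y b := fun h => h.tail hab
    by_cases ha : Relation.ReflTransGen r y a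
    · simp [ha, this ha]
    · by_cases hb : Relation.ReflTransGen r y b <;> simp [ha, hb]
  · have hyy : Relation.ReflTransGen r y y := .refl
    rw [restrictPair_append, restrictPair_filter, restrictPair_filter]
    rcases restrictPair_eq_or hnd hT hxy with e | e <;> simp [e, h, hyy]

/-- If the level function `s` drops by at most one along each arrow and never rises, then the
word `S₁₂S₂S₀S₀₁`, made of the topologically sorted unions of levels, follows the arrows. -/
lemma exists_follows_of_level {T : List V} (hnd : T.Nodup) (hT : ∀ v, v ∈ T)
    (hs : T.Pairwise fun a b => ¬ r b a) (hirr : ∀ v, ¬ r v v) (s : V → ℕ) (hs₂ : ∀ v, s v ≤ 2)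
    (hanti : ∀ a b, r a b → s b ≤ s a) (hdrop : ∀ a b, r a b → s a ≤ s b + 1)
    {x y : V} (hx : s x = 2) (hy : s y = 0) :
    ∃ w, Follows r w ∧ ¬ Alternates w x y := by
  have hxy : x ≠ y := by rintro rfl; omega
  refine ⟨T.filter (fun u => 1 ≤ s u) ++ T.filter (fun u => s u = 2) ++
    T.filter (fun u => s u = 0) ++ T.filter (fun u => s u ≤ 1), fun a b hab => ⟨2, ?_⟩, ?_⟩
  · have hne : a ≠ b := fun e => hirr b (e ▸ hab)
    simp only [restrictPair_append, restrictPair_filter,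
      restrictPair_eq_of_rel hnd hT hs hab hne]
    have h₁ := hanti a b hab
    have h₂ := hdrop a b hab
    have h₃ := hs₂ a
    have : s a = 0 ∧ s b = 0 ∨ s a = 1 ∧ s b = 0 ∨ s a = 1 ∧ s b = 1 ∨ s a = 2 ∧ s b = 1 ∨
      s a = 2 ∧ s b = 2 := by omega
    rcases this with h | h | h | h | h <;> simp [h.1, h.2, List.replicate_succ]
  · change ¬ (restrictPair _ x y).IsChain (· ≠ ·)
    simp only [restrictPair_append, restrictPair_filter]
    rcases restrictPair_eq_or hnd hT hxy with e | e <;> simp [e, hx, hy]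

/-- If `x` reaches `y` without an arrow, some word following the orientation separates them. -/
lemma IsSemiTransitiveOrientation.exists_follows_of_reaches {G : SimpleGraph V}
    (h : IsSemiTransitiveOrientation G r) {T : List V} (hnd : T.Nodup) (hT : ∀ v, v ∈ T)
    (hs : T.Pairwise fun a b => ¬ r b a) {x y : V} (hne : x ≠ y) (hxy : ¬ r x y)
    (hreach : Relation.ReflTransGen r x y) :
    ∃ w, Follows r w ∧ ¬ Alternates w x y := by
  classical
  let P : V → Prop := fun u => Relation.ReflTransGen r y u
  let Q : V → Prop := fun u => ∃ a b, Relation.ReflTransGen r a u ∧ r a b ∧ P b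
  have hP : ∀ a b, r a b → P a → P b := fun a b hab ha => ha.tail hab
  have hQ : ∀ a b, r a b → Q a → Q b := fun a b hab ⟨c, d, hc, hcd⟩ => ⟨c, d, hc.tail hab, hcd⟩
  have hPQ : ∀ a b, r a b → P b → Q a := fun a b hab hb => ⟨a, b, .refl, hab, hb⟩
  have hxP : ¬ P x := by
    intro hyx
    rcases Relation.reflTransGen_iff_eq_or_transGen.1 hreach with e | e
    · exact hne e.symm
    · exact h.2.1 x (e.trans_left hyx)
  have hxQ : ¬ Q x := fun ⟨a, b, hax, hab, hyb⟩ => hxy (h.rel_of_bridge hax hreach hyb hab hne)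
  have hyP : P y := .refl
  clear_value Q P
  refine exists_follows_of_level hnd hT hs h.1.irrefl
    (fun u => if P u then 0 else if Q u then 1 else 2) ?_ ?_ ?_
    (by simp [hxP, hxQ]) (by simp [hyP])
  · intro v
    split_ifs <;> omega
  · intro a b hab
    have h₁ := hP a b hab
    have h₂ := hQ a b hab
    split_ifs <;> first | omega | tauto
  · intro a b hab
    have h₁ := hPQ a b hab
    split_ifs <;> first | omega | tauto

/-- Every nonadjacent pair is separated by some word following the orientation. -/
lemma IsSemiTransitiveOrientation.exists_follows_not_alternates {G : SimpleGraph V}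
    (h : IsSemiTransitiveOrientation G r) {T : List V} (hnd : T.Nodup) (hT : ∀ v, v ∈ T)
    (hs : T.Pairwise fun a b => ¬ r b a) {x y : V} (hne : x ≠ y) (hxy : ¬ G.Adj x y) :
    ∃ w, Follows r w ∧ ¬ Alternates w x y := by
  rw [h.1.adj_iff, not_or] at hxy
  by_cases h₁ : Relation.ReflTransGen r x y
  · exact h.exists_follows_of_reaches hnd hT hs hne hxy.1 h₁
  by_cases h₂ : Relation.ReflTransGen r y x
  · obtain ⟨w, hw, hw'⟩ := h.exists_follows_of_reaches hnd hT hs hne.symm hxy.2 h₂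
    exact ⟨w, hw, fun e => hw' (alternates_comm.1 e)⟩
  obtain ⟨v, hv, ev⟩ := exists_follows_of_not_reaches hnd hT hs h.1.irrefl hne h₂
  obtain ⟨w, hw, ew⟩ := exists_follows_of_not_reaches hnd hT hs h.1.irrefl hne.symm h₁
  refine ⟨v ++ w, hv.append hw, ?_⟩
  change ¬ (restrictPair _ x y).IsChain (· ≠ ·)
  rw [restrictPair_append, ev, restrictPair_comm w, ew]
  simp

lemma IsSemiTransitiveOrientation.wordRepresentable [Fintype V] {G : SimpleGraph V}
    (h : IsSemiTransitiveOrientation G r) : WordRepresentable G := by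
  obtain ⟨T, hnd, hT, hs⟩ := h.2.1.exists_topologicalSort
  have hTf : Follows r T := fun a b hab => ⟨1, by
    simpa using restrictPair_eq_of_rel hnd hT hs hab fun e => h.1.irrefl b (e ▸ hab)⟩
  have hex : ∀ e : V × V, ∃ w, Follows r w ∧
      (e.1 ≠ e.2 → ¬ G.Adj e.1 e.2 → ¬ Alternates w e.1 e.2) := by
    intro e
    by_cases he : e.1 ≠ e.2 ∧ ¬ G.Adj e.1 e.2
    · obtain ⟨w, hw, hw'⟩ := h.exists_follows_not_alternates hnd hT hs he.1 he.2
      exact ⟨w, hw, fun _ _ => hw'⟩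
    · exact ⟨T, hTf, fun h₁ h₂ => absurd ⟨h₁, h₂⟩ he⟩
  choose W hW hsep using hex
  let L := T :: (Finset.univ : Finset (V × V)).toList.map W
  have hL : Follows r L.flatten := by
    refine Follows.flatten fun w hw => ?_
    rcases List.mem_cons.1 hw with rfl | hw
    · exact hTf
    · obtain ⟨e, -, rfl⟩ := List.mem_map.1 hw
      exact hW e
  refine ⟨L.flatten, fun v => by simp [L, hT], fun x y hne => ⟨fun halt => ?_, fun hadj => ?_⟩⟩
  · by_contra hadj
    have hmem : W (x, y) ∈ L := by simp [L]
    exact hsep (x, y) hne hadj (halt.of_infix (List.infix_of_mem_flatten hmem))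
  · rcases (h.1.adj_iff x y).1 hadj with hr | hr
    · exact hL.alternates hr hne
    · exact alternates_comm.1 (hL.alternates hr hne.symm)

end Construction

/-- A finite simple graph is word-representable if and only if it admits a
semi-transitive orientation. -/
theorem stmt0 {V : Type*} [Fintype V] [DecidableEq V] (G : SimpleGraph V) :
    WordRepresentable G ↔ ∃ r : V → V → Prop, IsSemiTransitiveOrientation G r :=
  ⟨fun ⟨_, hw⟩ => ⟨_, hw.isSemiTransitiveOrientation⟩, fun ⟨_, hr⟩ => hr.wordRepresentable⟩
end

section
/- Let S be a finite split graph, with vertex set partitioned into a clique and an independent set. Then S is a comparability graph if and only if S does not contain an induced subgraph isomorphic to B₁, B₂, or B₃, where: B₁ has vertices {a,b,c,d,e,f} and edge set {ac, bd, cd, ce, de, ef}; B₂ has vertices {a,b,c,d,e,f} and edge set {ab, bc, ad, db, be, ce, de, df, ef}; B₃ has vertices {a,b,c,d,e,f,g} and edge set {ac, bd, cd, ce, cf, df, dg, ef, fg}. -/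
/-- `r` is a transitive orientation of `G`. -/
def IsTransitiveOrientation {V : Type*} (G : SimpleGraph V) (r : V → V → Prop) : Prop :=
  IsOrientation G r ∧ ∀ u v z, r u v → r v z → r u z

/-- A graph is a comparability graph if it admits a transitive orientation. -/
def IsComparabilityGraph {V : Type*} (G : SimpleGraph V) : Prop :=
  ∃ r : V → V → Prop, IsTransitiveOrientation G r

/-- The graph `B₁` on vertices `a,…,f = 0,…,5` with edges
`ac, bd, cd, ce, de, ef`. -/
def B1 : SimpleGraph (Fin 6) :=
  SimpleGraph.fromRel fun u v =>
    (u, v) ∈ [((0 : Fin 6), (2 : Fin 6)), (1, 3), (2, 3), (2, 4), (3, 4), (4, 5)]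

/-- The graph `B₂` on vertices `a,…,f = 0,…,5` with edges
`ab, bc, ad, db, be, ce, de, df, ef`. -/
def B2 : SimpleGraph (Fin 6) :=
  SimpleGraph.fromRel fun u v =>
    (u, v) ∈ [((0 : Fin 6), (1 : Fin 6)), (1, 2), (0, 3), (3, 1), (1, 4), (2, 4),
      (3, 4), (3, 5), (4, 5)]

/-- The graph `B₃` on vertices `a,…,g = 0,…,6` with edges
`ac, bd, cd, ce, cf, df, dg, ef, fg`. -/
def B3 : SimpleGraph (Fin 7) :=
  SimpleGraph.fromRel fun u v =>
    (u, v) ∈ [((0 : Fin 7), (2 : Fin 7)), (1, 3), (2, 3), (2, 4), (2, 5), (3, 5),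
      (3, 6), (4, 5), (5, 6)]

instance : DecidableRel B1.Adj := fun u v =>
  inferInstanceAs (Decidable (u ≠ v ∧ (_ ∨ _)))

instance : DecidableRel B2.Adj := fun u v =>
  inferInstanceAs (Decidable (u ≠ v ∧ (_ ∨ _)))

instance : DecidableRel B3.Adj := fun u v =>
  inferInstanceAs (Decidable (u ≠ v ∧ (_ ∨ _)))

theorem IsComparabilityGraph.of_embedding {V W : Type*} {G : SimpleGraph V} {H : SimpleGraph W}
    (f : H ↪g G) (h : IsComparabilityGraph G) : IsComparabilityGraph H := by
  obtain ⟨r, ⟨hirr, hasymm, hadj⟩, htrans⟩ := h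
  exact ⟨fun u v => r (f u) (f v), ⟨fun v => hirr _, fun u v => hasymm _ _,
    fun u v => by rw [← f.map_adj_iff, hadj]⟩, fun u v z => htrans _ _ _⟩

/-- Two edges meeting in a vertex `v` whose other ends are not adjacent are oriented
both into `v` or both out of `v`. -/
theorem IsTransitiveOrientation.rel_iff {V : Type*} {G : SimpleGraph V} {r : V → V → Prop}
    (h : IsTransitiveOrientation G r) {u v w : V} (huv : G.Adj u v) (hvw : G.Adj v w)
    (huw : ¬ G.Adj u w) : r u v ↔ r w v := by
  obtain ⟨⟨_, hasymm, hadj⟩, htrans⟩ := h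
  grind

theorem not_isComparabilityGraph_B1 : ¬ IsComparabilityGraph B1 := by
  rintro ⟨r, h⟩
  have h₁ := h.rel_iff (u := 0) (v := 2) (w := 3) (by decide) (by decide) (by decide)
  have h₂ := h.rel_iff (u := 0) (v := 2) (w := 4) (by decide) (by decide) (by decide)
  have h₃ := h.rel_iff (u := 1) (v := 3) (w := 2) (by decide) (by decide) (by decide)
  have h₄ := h.rel_iff (u := 1) (v := 3) (w := 4) (by decide) (by decide) (by decide)
  have h₅ := h.rel_iff (u := 5) (v := 4) (w := 2) (by decide) (by decide) (by decide)
  have h₆ := h.rel_iff (u := 5) (v := 4) (w := 3) (by decide) (by decide) (by decide)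
  have a₁ := (h.1.adj_iff 2 3).1 (by decide)
  have a₂ := (h.1.adj_iff 2 4).1 (by decide)
  have a₃ := (h.1.adj_iff 3 4).1 (by decide)
  have := h.1.asymm
  grind

theorem not_isComparabilityGraph_B2 : ¬ IsComparabilityGraph B2 := by
  rintro ⟨r, h⟩
  have h₁ := h.rel_iff (u := 0) (v := 1) (w := 4) (by decide) (by decide) (by decide)
  have h₂ := h.rel_iff (u := 0) (v := 3) (w := 4) (by decide) (by decide) (by decide)
  have h₃ := h.rel_iff (u := 2) (v := 1) (w := 3) (by decide) (by decide) (by decide)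
  have h₄ := h.rel_iff (u := 2) (v := 4) (w := 3) (by decide) (by decide) (by decide)
  have h₅ := h.rel_iff (u := 5) (v := 3) (w := 1) (by decide) (by decide) (by decide)
  have h₆ := h.rel_iff (u := 5) (v := 4) (w := 1) (by decide) (by decide) (by decide)
  have h₇ := h.rel_iff (u := 0) (v := 1) (w := 2) (by decide) (by decide) (by decide)
  have h₈ := h.rel_iff (u := 0) (v := 3) (w := 5) (by decide) (by decide) (by decide)
  have h₉ := h.rel_iff (u := 2) (v := 4) (w := 5) (by decide) (by decide) (by decide)
  have a₁ := (h.1.adj_iff 1 3).1 (by decide)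
  have a₂ := (h.1.adj_iff 1 4).1 (by decide)
  have a₃ := (h.1.adj_iff 3 4).1 (by decide)
  have := h.1.asymm
  grind

theorem not_isComparabilityGraph_B3 : ¬ IsComparabilityGraph B3 := by
  rintro ⟨r, h⟩
  have h₁ := h.rel_iff (u := 0) (v := 2) (w := 3) (by decide) (by decide) (by decide)
  have h₂ := h.rel_iff (u := 0) (v := 2) (w := 5) (by decide) (by decide) (by decide)
  have h₃ := h.rel_iff (u := 1) (v := 3) (w := 2) (by decide) (by decide) (by decide)
  have h₄ := h.rel_iff (u := 1) (v := 3) (w := 5) (by decide) (by decide) (by decide)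
  have h₅ := h.rel_iff (u := 4) (v := 5) (w := 3) (by decide) (by decide) (by decide)
  have h₆ := h.rel_iff (u := 6) (v := 5) (w := 2) (by decide) (by decide) (by decide)
  have h₇ := h.rel_iff (u := 4) (v := 5) (w := 6) (by decide) (by decide) (by decide)
  have a₁ := (h.1.adj_iff 2 3).1 (by decide)
  have a₂ := (h.1.adj_iff 2 5).1 (by decide)
  have a₃ := (h.1.adj_iff 3 5).1 (by decide)
  have := h.1.asymm
  grind

/-- An adjacency-preserving and -reflecting map out of a graph without twins is an embedding. -/
theorem SimpleGraph.nonempty_embedding_of_adj_iff {V W : Type*} {G : SimpleGraph V}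
    {H : SimpleGraph W} (htwin : ∀ i j, (∀ k, H.Adj i k ↔ H.Adj j k) → i = j) (f : W → V)
    (hf : ∀ i j, G.Adj (f i) (f j) ↔ H.Adj i j) : Nonempty (H ↪g G) :=
  ⟨⟨⟨f, fun i j hij => htwin i j fun k => by rw [← hf, ← hf, hij]⟩, fun {i j} => hf i j⟩⟩

/-- Some vertex of `E` is joined to `x`, `y`, `z` exactly as prescribed by `p`, `q`, `r`. -/
def SimpleGraph.HasTrace {V : Type*} (G : SimpleGraph V) (E : Set V) (x y z : V)
    (p q r : Prop) : Prop :=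
  ∃ e ∈ E, (G.Adj x e ↔ p) ∧ (G.Adj y e ↔ q) ∧ (G.Adj z e ↔ r)

section HasTrace

variable {V : Type*} {G : SimpleGraph V} {E : Set V} {x y z : V} {p q r : Prop}

theorem SimpleGraph.HasTrace.rotate (h : G.HasTrace E x y z p q r) :
    G.HasTrace E y z x q r p := by
  obtain ⟨e, he, hx, hy, hz⟩ := h
  exact ⟨e, he, hy, hz, hx⟩

theorem SimpleGraph.hasTrace_or_of_exists (h : ∃ e ∈ E, G.Adj x e ∧ ¬ G.Adj y e) :
    G.HasTrace E x y z True False False ∨ G.HasTrace E x y z True False True := by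
  obtain ⟨e, he, hx, hy⟩ := h
  by_cases hz : G.Adj z e
  · exact .inr ⟨e, by simp [*]⟩
  · exact .inl ⟨e, by simp [*]⟩

theorem SimpleGraph.hasTrace_or_of_exists' (h : ∃ e ∈ E, G.Adj x e ∧ ¬ G.Adj z e) :
    G.HasTrace E x y z True False False ∨ G.HasTrace E x y z True True False := by
  obtain ⟨e, he, hx, hz⟩ := h
  by_cases hy : G.Adj y e
  · exact .inr ⟨e, by simp [*]⟩
  · exact .inl ⟨e, by simp [*]⟩

theorem SimpleGraph.nonempty_embedding_B1 (hE : ∀ u ∈ E, ∀ v ∈ E, ¬ G.Adj u v)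
    (hxy : G.Adj x y) (hxz : G.Adj x z) (hyz : G.Adj y z)
    (hX : G.HasTrace E x y z True False False) (hY : G.HasTrace E x y z False True False)
    (hZ : G.HasTrace E x y z False False True) : Nonempty (B1 ↪g G) := by
  obtain ⟨u, hu, hxu, hyu, hzu⟩ := hX
  obtain ⟨v, hv, hxv, hyv, hzv⟩ := hY
  obtain ⟨w, hw, hxw, hyw, hzw⟩ := hZ
  refine nonempty_embedding_of_adj_iff (by decide) ![u, v, x, y, z, w] fun i j => ?_
  have := hE u hu v hv
  have := hE u hu w hw
  have := hE v hv w hw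
  fin_cases i <;> fin_cases j <;> simp [B1, *, G.adj_comm]

theorem SimpleGraph.nonempty_embedding_B2 (hE : ∀ u ∈ E, ∀ v ∈ E, ¬ G.Adj u v)
    (hxy : G.Adj x y) (hxz : G.Adj x z) (hyz : G.Adj y z)
    (hXY : G.HasTrace E x y z True True False) (hXZ : G.HasTrace E x y z True False True)
    (hYZ : G.HasTrace E x y z False True True) : Nonempty (B2 ↪g G) := by
  obtain ⟨u, hu, hxu, hyu, hzu⟩ := hXY
  obtain ⟨v, hv, hxv, hyv, hzv⟩ := hXZ
  obtain ⟨w, hw, hxw, hyw, hzw⟩ := hYZ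
  refine nonempty_embedding_of_adj_iff (by decide) ![u, x, v, y, z, w] fun i j => ?_
  have := hE u hu v hv
  have := hE u hu w hw
  have := hE v hv w hw
  fin_cases i <;> fin_cases j <;> simp [B2, *, G.adj_comm]

theorem SimpleGraph.nonempty_embedding_B3 (hE : ∀ u ∈ E, ∀ v ∈ E, ¬ G.Adj u v)
    (hxy : G.Adj x y) (hxz : G.Adj x z) (hyz : G.Adj y z)
    (hX : G.HasTrace E x y z True False False) (hY : G.HasTrace E x y z False True False)
    (hXZ : G.HasTrace E x y z True False True) (hYZ : G.HasTrace E x y z False True True) :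
    Nonempty (B3 ↪g G) := by
  obtain ⟨a, ha, hxa, hya, hza⟩ := hX
  obtain ⟨b, hb, hxb, hyb, hzb⟩ := hY
  obtain ⟨e, he, hxe, hye, hze⟩ := hXZ
  obtain ⟨g, hg, hxg, hyg, hzg⟩ := hYZ
  refine nonempty_embedding_of_adj_iff (by decide) ![a, b, x, y, e, z, g] fun i j => ?_
  have := hE a ha b hb
  have := hE a ha e he
  have := hE a ha g hg
  have := hE b hb e he
  have := hE b hb g hg
  have := hE e he g hg
  fin_cases i <;> fin_cases j <;> simp [B3, *, G.adj_comm]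

/-- In a split graph, three clique vertices whose neighbourhoods in the independent set `E` are
pairwise incomparable yield one of `B1`, `B2`, `B3`. -/
theorem SimpleGraph.nonempty_embedding_of_incomparable (hE : ∀ u ∈ E, ∀ v ∈ E, ¬ G.Adj u v)
    (hxy : G.Adj x y) (hxz : G.Adj x z) (hyz : G.Adj y z)
    (exy : ∃ e ∈ E, G.Adj x e ∧ ¬ G.Adj y e) (eyx : ∃ e ∈ E, G.Adj y e ∧ ¬ G.Adj x e)
    (exz : ∃ e ∈ E, G.Adj x e ∧ ¬ G.Adj z e) (ezx : ∃ e ∈ E, G.Adj z e ∧ ¬ G.Adj x e)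
    (eyz : ∃ e ∈ E, G.Adj y e ∧ ¬ G.Adj z e) (ezy : ∃ e ∈ E, G.Adj z e ∧ ¬ G.Adj y e) :
    Nonempty (B1 ↪g G) ∨ Nonempty (B2 ↪g G) ∨ Nonempty (B3 ↪g G) := by
  have hX : G.HasTrace E x y z True False False ∨
      G.HasTrace E x y z True False True ∧ G.HasTrace E x y z True True False :=
    or_and_left.2 ⟨hasTrace_or_of_exists exy, hasTrace_or_of_exists' exz⟩
  have hY : G.HasTrace E x y z False True False ∨
      G.HasTrace E x y z True True False ∧ G.HasTrace E x y z False True True :=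
    or_and_left.2
      ⟨(hasTrace_or_of_exists eyz).imp (fun h => h.rotate.rotate) (fun h => h.rotate.rotate),
        (hasTrace_or_of_exists' eyx).imp (fun h => h.rotate.rotate) (fun h => h.rotate.rotate)⟩
  have hZ : G.HasTrace E x y z False False True ∨
      G.HasTrace E x y z False True True ∧ G.HasTrace E x y z True False True :=
    or_and_left.2 ⟨(hasTrace_or_of_exists ezx).imp (fun h => h.rotate) (fun h => h.rotate),
        (hasTrace_or_of_exists' ezy).imp (fun h => h.rotate) (fun h => h.rotate)⟩
  rcases hX with hX | ⟨hXZ, hXY⟩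
  · rcases hY with hY | ⟨hXY, hYZ⟩
    · rcases hZ with hZ | ⟨hYZ, hXZ⟩
      · exact .inl (nonempty_embedding_B1 hE hxy hxz hyz hX hY hZ)
      · exact .inr (.inr (nonempty_embedding_B3 hE hxy hxz hyz hX hY hXZ hYZ))
    · rcases hZ with hZ | ⟨-, hXZ⟩
      · exact .inr (.inr (nonempty_embedding_B3 hE hxz.symm hyz.symm hxy hZ.rotate.rotate
          hX.rotate.rotate hYZ.rotate.rotate hXY.rotate.rotate))
      · exact .inr (.inl (nonempty_embedding_B2 hE hxy hxz hyz hXY hXZ hYZ))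
  · rcases hY with hY | ⟨-, hYZ⟩
    · rcases hZ with hZ | ⟨hYZ, -⟩
      · exact .inr (.inr (nonempty_embedding_B3 hE hyz hxy.symm hxz.symm hY.rotate hZ.rotate
          hXY.rotate hXZ.rotate))
      · exact .inr (.inl (nonempty_embedding_B2 hE hxy hxz hyz hXY hXZ hYZ))
    · exact .inr (.inl (nonempty_embedding_B2 hE hxy hxz hyz hXY hXZ hYZ))

end HasTrace

/-- A finite set without three pairwise incomparable elements is a union of two chains. -/
theorem Finset.exists_two_chains {α : Type*} [Preorder α] (s : Finset α)
    (h : ∀ x ∈ s, ∀ y ∈ s, ∀ z ∈ s, x ≤ y ∨ y ≤ x ∨ x ≤ z ∨ z ≤ x ∨ y ≤ z ∨ z ≤ y) :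
    ∃ A : Set α, (∀ x ∈ s, ∀ y ∈ s, x ∈ A → y ∈ A → x ≤ y ∨ y ≤ x) ∧
      (∀ x ∈ s, ∀ y ∈ s, x ∉ A → y ∉ A → x ≤ y ∨ y ≤ x) := by
  classical
  induction hn : s.card generalizing s with
  | zero => exact ⟨∅, by simp_all⟩
  | succ n ih =>
    obtain ⟨a, ha, hmax⟩ := s.exists_maximal (Finset.card_pos.1 (by omega))
    obtain ⟨A, hA, hB⟩ := ih (s.erase a) (fun x hx y hy z hz =>
      h x (Finset.mem_of_mem_erase hx) y (Finset.mem_of_mem_erase hy) z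
        (Finset.mem_of_mem_erase hz)) (by rw [Finset.card_erase_of_mem ha]; omega)
    have hI : ∀ x ∈ s, ∀ y ∈ s, ¬ x ≤ a → ¬ y ≤ a → x ≤ y ∨ y ≤ x := by
      intro x hx y hy hxa hya
      have := h x hx y hy a ha
      have := @hmax x hx
      have := @hmax y hy
      tauto
    simp only [Finset.mem_erase, and_imp] at hA hB
    clear ih h hmax
    have hne : ∀ k, ¬ k ≤ a → k ≠ a := fun k hk h => hk h.le
    -- The elements not below `a` can be put on top of the lower part of one of the chains.
    by_cases hlow : ∃ x ∈ s, x ∈ A ∧ x ≠ a ∧ x ≤ a ∧ ∃ i ∈ s, ¬ i ≤ a ∧ ¬ x ≤ i ∧ ¬ i ≤ x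
    · obtain ⟨x, hx, hxA, hxa, hxle, i, hi, hia, hxi, hix⟩ := hlow
      have hcomp : ∀ y ∈ s, y ≠ a → y ∉ A → y ≤ a → ∀ j ∈ s, ¬ j ≤ a → y ≤ j ∨ j ≤ y := by
        intro y hy hya' hyA hya j hj hja
        by_cases hjA : j ∈ A
        · have hiA : i ∉ A := fun hiA =>
            (hA x hxa hx i (hne i hia) hi hxA hiA).elim hxi hix
          have hyi : y ≤ i := (hB y hya' hy i (hne i hia) hi hyA hiA).resolve_right
            fun hiy => hia (hiy.trans hya)
          have hxj : x ≤ j := (hA x hxa hx j (hne j hja) hj hxA hjA).resolve_right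
            fun hjx => hja (hjx.trans hxle)
          exact .inl (hyi.trans ((hI i hi j hj hia hja).resolve_right fun hji =>
            hxi (hxj.trans hji)))
        · exact hB y hya' hy j (hne j hja) hj hyA hjA
      refine ⟨{y | y = a ∨ (y ≤ a ∧ y ∈ A)}, ?_, ?_⟩ <;>
        simp only [Set.mem_ofPred_eq] <;> intro u hu v hv <;> by_cases hua : u = a <;>
        by_cases hva : v = a <;> grind
    · refine ⟨{y | y ≠ a ∧ (¬ y ≤ a ∨ y ∈ A)}, ?_, ?_⟩ <;>
        simp only [Set.mem_ofPred_eq] <;> intro u hu v hv <;> by_cases hua : u = a <;>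
        by_cases hva : v = a <;> grind

/-- A finite split graph is a comparability graph iff it contains no induced subgraph
isomorphic to `B₁`, `B₂` or `B₃` (an induced subgraph containment is a graph embedding). -/
theorem stmt3 {V : Type*} [Fintype V] (G : SimpleGraph V) (K E : Set V)
    (hdisj : Disjoint K E) (hunion : K ∪ E = Set.univ)
    (hK : G.IsClique K) (hE : ∀ u ∈ E, ∀ v ∈ E, ¬ G.Adj u v) :
    IsComparabilityGraph G ↔
      IsEmpty (B1 ↪g G) ∧ IsEmpty (B2 ↪g G) ∧ IsEmpty (B3 ↪g G) := by
  classical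
  refine ⟨fun h => ⟨⟨fun f => not_isComparabilityGraph_B1 (h.of_embedding f)⟩,
    ⟨fun f => not_isComparabilityGraph_B2 (h.of_embedding f)⟩,
    ⟨fun f => not_isComparabilityGraph_B3 (h.of_embedding f)⟩⟩, ?_⟩
  rintro ⟨h₁, h₂, h₃⟩
  let N : V → Finset V := fun x => {e | e ∈ E ∧ G.Adj x e}
  have hN : ∀ x e, e ∈ N x ↔ e ∈ E ∧ G.Adj x e := by simp [N]
  have hKE : ∀ v, v ∈ K ↔ v ∉ E := fun v =>
    ⟨fun hv => Set.disjoint_left.1 hdisj hv, fun hv =>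
      (hunion.ge (Set.mem_univ v)).resolve_right hv⟩
  have hne : ∀ p q, ¬ N p ⊆ N q → p ≠ q ∧ ∃ e ∈ E, G.Adj p e ∧ ¬ G.Adj q e := by
    intro p q hpq
    refine ⟨fun h => hpq (h ▸ subset_rfl), ?_⟩
    obtain ⟨e, he, he'⟩ := Finset.not_subset.1 hpq
    grind
  obtain ⟨A, hA, hB⟩ : ∃ A : Set V,
      (∀ x ∈ K, ∀ y ∈ K, x ∈ A → y ∈ A → N x ⊆ N y ∨ N y ⊆ N x) ∧
      (∀ x ∈ K, ∀ y ∈ K, x ∉ A → y ∉ A → N x ⊆ N y ∨ N y ⊆ N x) := by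
    let _ : Preorder V := Preorder.lift N
    have hchains := Finset.exists_two_chains {x | x ∈ K} (by
      intro x hx y hy z hz
      simp only [Finset.mem_filter, Finset.mem_univ, true_and] at hx hy hz
      by_contra! hcon
      obtain ⟨hxy, hyx, hxz, hzx, hyz, hzy⟩ := hcon
      have := SimpleGraph.nonempty_embedding_of_incomparable hE
        (hK hx hy (hne _ _ hxy).1) (hK hx hz (hne _ _ hxz).1) (hK hy hz (hne _ _ hyz).1)
        (hne _ _ hxy).2 (hne _ _ hyx).2 (hne _ _ hxz).2 (hne _ _ hzx).2
        (hne _ _ hyz).2 (hne _ _ hzy).2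
      simp only [← not_isEmpty_iff] at this
      tauto)
    simp only [Finset.mem_filter, Finset.mem_univ, true_and] at hchains
    exact hchains
  -- Order the clique: first `A` by decreasing, then the rest by increasing neighbourhoods.
  obtain ⟨lt, hirr, htrans, htotal, hltA, hltB, hAB⟩ : ∃ lt : V → V → Prop,
      (∀ x, ¬ lt x x) ∧ (∀ x y z, lt x y → lt y z → lt x z) ∧
      (∀ x y, x ≠ y → lt x y ∨ lt y x) ∧
      (∀ x ∈ K, ∀ y ∈ K, x ∈ A → y ∈ A → lt x y → N y ⊆ N x) ∧
      (∀ x ∈ K, ∀ y ∈ K, x ∉ A → y ∉ A → lt x y → N x ⊆ N y) ∧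
      (∀ x y, x ∉ A → y ∈ A → ¬ lt x y) := by
    let d : V → ℤ := fun x => if x ∈ A then -((N x).card : ℤ) else (N x).card + 1
    let e := Fintype.equivFin V
    have hcard : ∀ x y, N x ⊆ N y → (N y).card ≤ (N x).card → N y ⊆ N x := fun x y hxy hle =>
      (Finset.eq_of_subset_of_card_le hxy hle).ge
    have hinj := e.injective
    refine ⟨fun x y => d x < d y ∨ (d x = d y ∧ e x < e y), ?_, ?_, ?_, ?_, ?_, ?_⟩
    · simp
    · grind
    · intro x y hxy
      have := hinj.ne hxy
      grind
    · intro x hx y hy hxA hyA hlt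
      have hle : (N y).card ≤ (N x).card := by
        simp only [d, hxA, hyA, if_true] at hlt
        omega
      exact (hA x hx y hy hxA hyA).elim (fun h => hcard x y h hle) id
    · intro x hx y hy hxA hyA hlt
      have hle : (N x).card ≤ (N y).card := by
        simp only [d, hxA, hyA, if_false] at hlt
        omega
      exact (hB x hx y hy hxA hyA).elim id (fun h => hcard y x h hle)
    · grind
  have hNsub : ∀ x y e, N x ⊆ N y → e ∈ E → G.Adj x e → G.Adj y e := fun x y e hxy he hxe =>
    ((hN y e).1 (hxy ((hN x e).2 ⟨he, hxe⟩))).2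
  have hirrefl : ∀ v, ¬ G.Adj v v := fun v => G.irrefl
  have hsymm := fun u v => G.adj_comm u v
  have hclique : ∀ x y, x ∈ K → y ∈ K → x ≠ y → G.Adj x y := fun x y hx hy => hK hx hy
  refine ⟨fun u v => G.Adj u v ∧
    ((u ∈ K ∧ v ∈ K ∧ lt u v) ∨ (u ∈ A ∧ u ∈ K ∧ v ∈ E) ∨ (u ∈ E ∧ v ∈ K ∧ v ∉ A)),
    ⟨?_, ?_, ?_⟩, ?_⟩
  · grind
  · grind
  · grind
  · rintro u v z ⟨huv, h | h | h⟩ ⟨hvz, h' | h' | h'⟩ <;> grind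
end

section
/- Let S be a finite split graph with vertex partition into a clique K and an independent set E, and let S' be the split graph obtained from S by adding a new vertex of degree 1 to the independent set, i.e., a new vertex adjacent to exactly one vertex of K. Then S is word-representable if and only if S' is word-representable. -/
theorem List.getLast?_dedup {α : Type*} [DecidableEq α] (l : List α) :
    l.dedup.getLast? = l.getLast? := by
  induction l with
  | nil => simp
  | cons a l ih =>
    by_cases h : a ∈ l
    · have hl : l ≠ [] := List.ne_nil_of_mem h
      rw [List.dedup_cons_of_mem h, ih, List.getLast?_cons, List.getLast?_eq_some_getLast hl]
      simp
    · rw [List.dedup_cons_of_notMem h, List.getLast?_cons, List.getLast?_cons, ih]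

theorem List.isChain_ne_append_dedup {α : Type*} [DecidableEq α] {l : List α} {x y : α}
    (hx : x ∈ l) (hy : y ∈ l) (hxy : x ≠ y) :
    (l ++ l.dedup).IsChain (· ≠ ·) ↔ l.IsChain (· ≠ ·) := by
  rw [List.isChain_append, ← List.getLast?_dedup l]
  refine ⟨fun h => h.1, fun h => ⟨h, (List.nodup_dedup l).isChain, ?_⟩⟩
  have hn := List.nodup_dedup l
  rw [← List.mem_dedup] at hx hy
  generalize l.dedup = d at *
  rintro a ha b hb rfl
  cases d with
  | nil => simp at hx
  | cons c d =>
    obtain rfl : c = a := by simpa using hb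
    cases d with
    | nil => simp_all
    | cons e d =>
      rw [List.getLast?_cons_cons] at ha
      exact (List.nodup_cons.1 hn).1 (List.mem_of_getLast? ha)

theorem List.filter_dedup_comm {α : Type*} [DecidableEq α] (p : α → Bool) (l : List α) :
    l.dedup.filter p = (l.filter p).dedup := by
  induction l with
  | nil => simp
  | cons a l ih =>
    by_cases h : a ∈ l <;> by_cases hp : p a <;>
      simp [h, hp, ih, List.dedup_cons_of_mem, List.dedup_cons_of_notMem]

theorem Alternates.symm {V : Type*} [DecidableEq V] {w : List V} {x y : V}
    (h : Alternates w x y) : Alternates w y x := by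
  simpa only [Alternates, or_comm] using h

/-- Appending the final permutation of a representing word yields a representing word. -/
theorem WordRepresents.append_dedup {V : Type*} [DecidableEq V] {G : SimpleGraph V} {w : List V}
    (h : WordRepresents G w) : WordRepresents G (w ++ w.dedup) := by
  refine ⟨fun v => List.mem_append_left _ (h.1 v), fun x y hxy => ?_⟩
  rw [← h.2 x y hxy, Alternates, Alternates, List.filter_append, List.filter_dedup_comm]
  exact List.isChain_ne_append_dedup (x := x) (y := y) (by simp [h.1]) (by simp [h.1]) hxy

theorem alternates_some_iff {V : Type*} [DecidableEq V] (l : List (Option V)) (u v : V) :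
    Alternates l (some u) (some v) ↔ Alternates l.reduceOption u v := by
  have h : (l.filter fun z => decide (z = some u ∨ z = some v)) =
      (l.reduceOption.filter fun z => decide (z = u ∨ z = v)).map some := by
    induction l with
    | nil => simp
    | cons a l ih =>
      cases a with
      | none => simpa using ih
      | some a => by_cases ha : a = u ∨ a = v <;> simpa [ha] using ih
  rw [Alternates, Alternates, h]
  refine (List.isChain_map some).trans ?_
  simp only [ne_eq, Option.some_inj]
  exact Iff.rfl

/-- Lift a word to `Option V`, inserting `none` after every occurrence of `a`. -/
def insertNoneAfter {V : Type*} [DecidableEq V] (a : V) (w : List V) : List (Option V) :=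
  w.flatMap fun v => if v = a then [some v, none] else [some v]

theorem reduceOption_insertNoneAfter {V : Type*} [DecidableEq V] (a : V) (w : List V) :
    (insertNoneAfter a w).reduceOption = w := by
  induction w with
  | nil => simp [insertNoneAfter]
  | cons b w ih =>
    rw [insertNoneAfter] at ih ⊢
    by_cases h : b = a <;> simp [h, ih]

theorem alternates_insertNoneAfter_append {V : Type*} [DecidableEq V] (a : V) (w : List V)
    {t : List (Option V)} (ht : Alternates t none (some a))
    (hd : none ∉ (t.filter fun z => decide (z = none ∨ z = some a)).head?) :
    Alternates (insertNoneAfter a w ++ t) none (some a) := by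
  suffices h : Alternates (insertNoneAfter a w ++ t) none (some a) ∧
      none ∉ ((insertNoneAfter a w ++ t).filter fun z => decide (z = none ∨ z = some a)).head? from
    h.1
  induction w with
  | nil => exact ⟨ht, hd⟩
  | cons b w ih =>
    by_cases h : b = a
    · subst h
      have e : insertNoneAfter b (b :: w) ++ t =
          some b :: none :: (insertNoneAfter b w ++ t) := by simp [insertNoneAfter]
      rw [e]
      refine ⟨?_, by simp⟩
      have := ih.1
      rw [Alternates] at this ⊢
      rw [List.filter_cons_of_pos (by simp), List.filter_cons_of_pos (by simp)]
      refine List.IsChain.cons_cons (by simp) (List.isChain_cons.2 ⟨?_, this⟩)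
      rintro y hy rfl
      exact ih.2 hy
    · have e : insertNoneAfter a (b :: w) ++ t = some b :: (insertNoneAfter a w ++ t) := by
        simp [insertNoneAfter, h]
      rw [e, Alternates, List.filter_cons_of_neg (by simp [h])]
      exact ih

theorem not_alternates_of_two_le_count {V : Type*} [DecidableEq V] {s m t : List V} {x y : V}
    (hx : x ∉ m) (hy : 2 ≤ m.count y) : ¬ Alternates (s ++ m ++ t) x y := by
  intro h
  rw [Alternates, List.filter_append, List.filter_append] at h
  have hm := (List.isChain_append.1 (List.isChain_append.1 h).1).2.1
  have e : (m.filter fun z => decide (z = x ∨ z = y)) = List.replicate (m.count y) y := by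
    rw [← List.filter_eq]
    refine List.filter_congr fun z hz => ?_
    have : z ≠ x := fun e => hx (e ▸ hz)
    simp [this, eq_comm]
  rw [e] at hm
  obtain ⟨n, hn⟩ := Nat.exists_eq_add_of_le' hy
  rw [hn, List.replicate_succ, List.replicate_succ, List.isChain_cons_cons] at hm
  exact hm.1 rfl

/-- Attaching a pendant vertex to any vertex preserves word-representability. -/
theorem WordRepresentable.attach_pendant {V : Type*} [DecidableEq V] {G : SimpleGraph V}
    {G' : SimpleGraph (Option V)} {a : V} (h : WordRepresentable G)
    (hold : ∀ u v : V, G'.Adj (some u) (some v) ↔ G.Adj u v)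
    (hnew : ∀ u : V, G'.Adj none (some u) ↔ u = a) : WordRepresentable G' := by
  obtain ⟨w, hw⟩ := h
  have e (l : List V) : (l ++ w.dedup).dedup = w.dedup := by
    rw [List.Subset.dedup_append_right (fun x _ => List.mem_dedup.2 (hw.1 x)), List.dedup_idem]
  have hr := hw.append_dedup.append_dedup.append_dedup
  rw [e, e] at hr
  have hmem (v : V) : v ∈ w.dedup := List.mem_dedup.2 (hw.1 v)
  have hnd := List.nodup_dedup w
  obtain ⟨p, q, hpq⟩ := List.append_of_mem (hmem a)
  generalize w.dedup = d at *
  subst hpq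
  have hap : a ∉ p := by grind
  have haq : a ∉ q := by grind
  let P := p.map some
  let Q := q.map some
  let m : List (Option V) := Q ++ P ++ some a :: Q ++ P
  let s := insertNoneAfter a w ++ P ++ [some a, none]
  let t := none :: some a :: Q
  have hred : (s ++ m ++ t).reduceOption =
      w ++ (p ++ a :: q) ++ (p ++ a :: q) ++ (p ++ a :: q) := by
    have (l : List V) : (l.map some).reduceOption = l := by
      simp [List.reduceOption]
    simp [s, m, t, P, Q, List.reduceOption_append, reduceOption_insertNoneAfter, this]
  have hnone (u : V) : Alternates (s ++ m ++ t) none (some u) ↔ G'.Adj none (some u) := by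
    rw [hnew]
    constructor
    · intro hu
      by_contra hua
      refine not_alternates_of_two_le_count (by simp [m, P, Q]) ?_ hu
      have hc := List.count_eq_one_of_mem hnd (hmem u)
      have hinj (l : List V) :
          @List.count (Option V) instBEqOfDecidableEq (some u) (l.map some) = l.count u :=
        @List.count_map_of_injective _ _ _ _ instBEqOfDecidableEq _ l some
          (Option.some_injective V) u
      simp only [m, P, Q, List.count_append, List.count_cons, hinj] at hc ⊢
      have : ¬ a = u := fun h => hua h.symm
      simp [this] at hc ⊢
      omega
    · rintro rfl
      have hf (l : List V) (hl : u ∉ l) :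
          ((l.map some).filter fun z => decide (z = none ∨ z = some u)) = [] := by
        simp only [List.filter_eq_nil_iff, List.mem_map]
        rintro _ ⟨b, hb, rfl⟩
        have : b ≠ u := fun h => hl (h ▸ hb)
        simpa using this
      have hs : s ++ m ++ t = insertNoneAfter u w ++ (P ++ [some u, none] ++ m ++ t) := by
        simp [s]
      rw [hs]
      have hcalc : ((P ++ [some u, none] ++ m ++ t).filter
          fun z => decide (z = none ∨ z = some u)) = [some u, none, some u, none, some u] := by
        simp only [m, t, P, Q, List.filter_append, List.filter_cons, hf p hap, hf q haq]
        simp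
      refine alternates_insertNoneAfter_append u w ?_ ?_
      · rw [Alternates, hcalc, List.Chain']
        simp
      · rw [hcalc]
        simp
  refine ⟨s ++ m ++ t, ?_, ?_⟩
  · rintro (_ | v)
    · simp [t]
    · rw [← List.reduceOption_mem_iff, hred]
      exact hr.1 v
  · rintro (_ | u) (_ | v) huv
    · exact absurd rfl huv
    · exact hnone v
    · rw [G'.adj_comm, ← hnone u]
      exact ⟨Alternates.symm, Alternates.symm⟩
    · rw [alternates_some_iff, hred, hold]
      exact hr.2 u v (fun h => huv (congrArg some h))

/-- Deleting the vertex `none` preserves word-representability. -/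
theorem WordRepresentable.of_option {V : Type*} [DecidableEq V] {G : SimpleGraph V}
    {G' : SimpleGraph (Option V)} (h : WordRepresentable G')
    (hold : ∀ u v : V, G'.Adj (some u) (some v) ↔ G.Adj u v) : WordRepresentable G := by
  obtain ⟨w, hw⟩ := h
  refine ⟨w.reduceOption, fun v => List.reduceOption_mem_iff.2 (hw.1 _), fun x y hxy => ?_⟩
  rw [← alternates_some_iff, hw.2 _ _ (by simpa using hxy), hold]

/-- Adding a new vertex of degree 1 to the independent set of a finite split graph,
adjacent to exactly one vertex `w₀` of the clique `K`, preserves and reflects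
word-representability. The new graph `G'` lives on `Option V`, with `none` the new
vertex. -/
theorem stmt7 {V : Type*} [Fintype V] [DecidableEq V] (G : SimpleGraph V)
    (K E : Finset V) (hdisj : Disjoint K E) (hunion : K ∪ E = Finset.univ)
    (hK : G.IsClique (K : Set V)) (hE : ∀ u ∈ E, ∀ v ∈ E, ¬ G.Adj u v)
    (G' : SimpleGraph (Option V)) (w₀ : V) (hw₀ : w₀ ∈ K)
    (hold : ∀ u v : V, G'.Adj (some u) (some v) ↔ G.Adj u v)
    (hnew : ∀ u : V, G'.Adj none (some u) ↔ u = w₀) :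
    WordRepresentable G ↔ WordRepresentable G' := by
  exact ⟨fun h => h.attach_pendant hold hnew, fun h => h.of_option hold⟩
end

section
/- Let D₁ be the split graph with vertex set {1,2,3,4,5,6} ∪ {a,b,c,d}, in which {1,2,3,4,5,6} induces a complete graph, {a,b,c,d} is an independent set, and the remaining edges are exactly: a adjacent to 1, 3, 5; b adjacent to 1, 2; c adjacent to 3, 4; d adjacent to 5, 6. Then the induced subgraph of D₁ obtained by deleting the vertex a is word-representable. -/
/-- Neighborhoods in the clique `{1,…,6}` (represented by `Fin 6`, with vertex `i+1`
represented by `i`) of the independent vertices `a, b, c, d` (represented by `Fin 4`):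
`a` is adjacent to `1,3,5`; `b` to `1,2`; `c` to `3,4`; `d` to `5,6`. -/
def D1nbr : Fin 4 → Finset (Fin 6)
  | 0 => {0, 2, 4}
  | 1 => {0, 1}
  | 2 => {2, 3}
  | 3 => {4, 5}

/-- The split graph `D₁`: the clique `{1,…,6}` (as `Fin 6`), the independent set
`{a,b,c,d}` (as `Fin 4`), and edges between them given by `D1nbr`. -/
def D1 : SimpleGraph (Fin 6 ⊕ Fin 4) :=
  SimpleGraph.fromRel fun u v =>
    match u, v with
    | Sum.inl _, Sum.inl _ => True
    | Sum.inl i, Sum.inr a => i ∈ D1nbr a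
    | _, _ => False

instance decidableAlternates {V : Type*} [DecidableEq V] (w : List V) (x y : V) :
    Decidable (Alternates w x y) :=
  inferInstanceAs (Decidable (List.IsChain _ _))

instance decidableRelD1Adj : DecidableRel D1.Adj
  | Sum.inl i, Sum.inl j => decidable_of_iff (i ≠ j) (by simp [D1])
  | Sum.inl i, Sum.inr a => decidable_of_iff (i ∈ D1nbr a) (by simp [D1])
  | Sum.inr a, Sum.inl i => decidable_of_iff (i ∈ D1nbr a) (by simp [D1])
  | Sum.inr _, Sum.inr _ => isFalse (by simp [D1])

/-- The word `b12b c34c d56d 123456`, where `1,…,6` are the clique vertices. -/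
def wordD1DeleteA : List {v : Fin 6 ⊕ Fin 4 | v ≠ Sum.inr 0} :=
  let k (i : Fin 6) : {v : Fin 6 ⊕ Fin 4 | v ≠ Sum.inr 0} := ⟨Sum.inl i, Sum.inl_ne_inr⟩
  let b : {v : Fin 6 ⊕ Fin 4 | v ≠ Sum.inr 0} := ⟨Sum.inr 1, by simp⟩
  let c : {v : Fin 6 ⊕ Fin 4 | v ≠ Sum.inr 0} := ⟨Sum.inr 2, by simp⟩
  let d : {v : Fin 6 ⊕ Fin 4 | v ≠ Sum.inr 0} := ⟨Sum.inr 3, by simp⟩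
  [b, k 0, k 1, b, c, k 2, k 3, c, d, k 4, k 5, d, k 0, k 1, k 2, k 3, k 4, k 5]

/-- Deleting the vertex `a` from `D₁` yields a word-representable graph. -/
theorem stmt11 :
    WordRepresentable (D1.induce {v : Fin 6 ⊕ Fin 4 | v ≠ Sum.inr 0}) := by
  have mem : ∀ v, v ≠ Sum.inr 0 → ∃ x ∈ wordD1DeleteA, x.1 = v := by decide
  have alternates_iff : ∀ u, ∀ hu : u ≠ Sum.inr 0, ∀ v, ∀ hv : v ≠ Sum.inr 0, u ≠ v →
      (Alternates wordD1DeleteA ⟨u, hu⟩ ⟨v, hv⟩ ↔ D1.Adj u v) := by decide +kernel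
  refine ⟨wordD1DeleteA, fun v => ?_, fun x y hxy =>
    alternates_iff x.1 x.2 y.1 y.2 fun h => hxy (Subtype.ext h)⟩
  obtain ⟨x, hx, hxv⟩ := mem v.1 v.2
  exact Subtype.ext hxv ▸ hx
end

section
/- Let D₁ be the split graph with vertex set {1,2,3,4,5,6} ∪ {a,b,c,d}, in which {1,2,3,4,5,6} induces a complete graph, {a,b,c,d} is an independent set, and the remaining edges are exactly: a adjacent to 1, 3, 5; b adjacent to 1, 2; c adjacent to 3, 4; d adjacent to 5, 6. Then the induced subgraph of D₁ obtained by deleting the vertex b is word-representable. -/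
instance Alternates.instDecidable {V : Type*} [DecidableEq V] (w : List V) (x y : V) :
    Decidable (Alternates w x y) :=
  inferInstanceAs (Decidable (List.IsChain _ _))

instance D1.instDecidableRelAdj : DecidableRel D1.Adj
  | .inl i, .inl j => decidable_of_iff (i ≠ j) (by simp [D1])
  | .inl i, .inr a => decidable_of_iff (i ∈ D1nbr a) (by simp [D1])
  | .inr a, .inl i => decidable_of_iff (i ∈ D1nbr a) (by simp [D1])
  | .inr _, .inr _ => .isFalse (by simp [D1])

/-- Deleting the vertex `b` from `D₁` yields a word-representable graph. -/
theorem stmt12 :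
    WordRepresentable (D1.induce {v : Fin 6 ⊕ Fin 4 | v ≠ Sum.inr 1}) := by
  -- The representing word is `13a42d65d1c34c26a5`.
  refine ⟨[⟨.inl 0, by decide⟩, ⟨.inl 2, by decide⟩, ⟨.inr 0, by decide⟩, ⟨.inl 3, by decide⟩,
      ⟨.inl 1, by decide⟩, ⟨.inr 3, by decide⟩, ⟨.inl 5, by decide⟩, ⟨.inl 4, by decide⟩,
      ⟨.inr 3, by decide⟩, ⟨.inl 0, by decide⟩, ⟨.inr 2, by decide⟩, ⟨.inl 2, by decide⟩,
      ⟨.inl 3, by decide⟩, ⟨.inr 2, by decide⟩, ⟨.inl 1, by decide⟩, ⟨.inl 5, by decide⟩,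
      ⟨.inr 0, by decide⟩, ⟨.inl 4, by decide⟩], ?_, ?_⟩
  · rintro ⟨i | a, hv⟩
    · fin_cases i <;> simp
    · fin_cases a <;> simp at hv ⊢
  · decide
end

section
/- Adding a universal vertex to a comparability graph yields a word-representable graph: if H is a finite comparability graph and G is obtained from H by adding a new vertex x adjacent to all vertices of H, then G is word-representable. -/
namespace List

variable {α : Type*}

/-- A concatenation of blocks `[x, y]` and `[y, x]` has no two equal consecutive letters
iff all blocks are equal. -/
theorem isChain_ne_flatten_iff {x y : α} (hxy : x ≠ y) (L : List (List α))
    (hL : ∀ l ∈ L, l = [x, y] ∨ l = [y, x]) :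
    L.flatten.IsChain (· ≠ ·) ↔ (∀ l ∈ L, l = [x, y]) ∨ ∀ l ∈ L, l = [y, x] := by
  induction L with
  | nil => simp
  | cons l L ih =>
    have ih := ih fun m hm => hL m (mem_cons_of_mem _ hm)
    cases L with
    | nil => rcases hL l (by simp) with rfl | rfl <;> simp [hxy, hxy.symm]
    | cons m L =>
      rcases hL l (by simp) with rfl | rfl <;> rcases hL m (by simp) with rfl | rfl <;>
        simp_all [hxy.symm]

/-- Restricting a duplicate-free list to two of its members leaves just these two. -/
theorem Nodup.filter_eq_or_eq_pair [DecidableEq α] {l : List α} (hl : l.Nodup) {x y : α}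
    (hxy : x ≠ y) (hx : x ∈ l) (hy : y ∈ l) :
    (l.filter fun z => decide (z = x ∨ z = y)) = [x, y] ∨
      (l.filter fun z => decide (z = x ∨ z = y)) = [y, x] := by
  have h : (l.filter fun z => decide (z = x ∨ z = y)).Perm [x, y] := by
    rw [perm_ext_iff_of_nodup (hl.filter _) (by simp [hxy])]
    intro a
    simp only [mem_filter, decide_eq_true_eq, mem_cons, not_mem_nil, or_false]
    constructor
    · exact And.right
    · rintro (rfl | rfl) <;> simp [*]
  simpa [← mem_permutations, permutations, permutationsAux, permutationsAux.rec] using h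

/-- If restricting `l` to two letters leaves `[x, y]`, then `x` is related to `y` by every
relation that holds pairwise along `l`. -/
theorem Pairwise.rel_of_filter_eq_pair {R : α → α → Prop} {l : List α} (hl : l.Pairwise R)
    {p : α → Bool} {x y : α} (h : l.filter p = [x, y]) : R x y := by
  have := hl.filter p
  rw [h] at this
  simpa using this

end List

/-- Every strict partial order on a finite type has a linear extension, as a list. -/
theorem exists_list_linearExtension {V : Type*} [Fintype V] (s : V → V → Prop)
    (hirrefl : ∀ a, ¬ s a a) (htrans : ∀ a b c, s a b → s b c → s a c) :
    ∃ l : List V, l.Nodup ∧ (∀ v, v ∈ l) ∧ l.Pairwise fun a b => ¬ s b a := by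
  classical
  have : IsPartialOrder V fun a b => a = b ∨ s a b :=
    { refl := fun a => Or.inl rfl
      trans := by
        rintro a b c (rfl | hab) (rfl | hbc)
        exacts [Or.inl rfl, Or.inr hbc, Or.inr hab, Or.inr (htrans _ _ _ hab hbc)]
      antisymm := by
        rintro a b (rfl | hab) (h | hba)
        exacts [rfl, rfl, h.symm, (hirrefl _ (htrans _ _ _ hab hba)).elim] }
  obtain ⟨t, ht, hst⟩ := extend_partialOrder fun a b => a = b ∨ s a b
  refine ⟨Finset.univ.sort t, Finset.sort_nodup _ _, fun v => by simp, ?_⟩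
  refine ((Finset.pairwise_sort _ t).and (Finset.sort_nodup _ t)).imp ?_
  rintro a b ⟨hab, hne⟩ hba
  exact hne (antisymm_of t hab (hst _ _ (Or.inr hba)))

/-- Incomparable elements of a finite strict partial order occur in either order in some
linear extension. -/
theorem exists_list_linearExtension_of_incomparable {V : Type*} [Fintype V]
    (r : V → V → Prop) (hirrefl : ∀ a, ¬ r a a) (htrans : ∀ a b c, r a b → r b c → r a c)
    {u v : V} (huv : u ≠ v) (hvu : ¬ r v u) :
    ∃ l : List V, l.Nodup ∧ (∀ w, w ∈ l) ∧ (l.Pairwise fun a b => ¬ r b a) ∧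
      l.Pairwise fun a b => ¬ (a = v ∧ b = u) := by
  obtain ⟨l, hnd, hmem, hl⟩ := exists_list_linearExtension
    (fun a b => r a b ∨ (a = u ∨ r a u) ∧ (b = v ∨ r v b)) (by grind) (by grind)
  exact ⟨l, hnd, hmem, hl.imp (by grind), hl.imp (by grind)⟩

/-- Finite comparability graphs are word-representable: concatenate all linear extensions of
a transitive orientation. -/
theorem IsComparabilityGraph.wordRepresentable {V : Type*} [Fintype V] [DecidableEq V]
    {G : SimpleGraph V} (hG : IsComparabilityGraph G) : WordRepresentable G := by
  classical
  obtain ⟨r, hr, htrans⟩ := hG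
  let S : List (List V) := Finset.univ.toList.permutations.filter
    fun l => decide (l.Pairwise fun a b => ¬ r b a)
  have mem_S (l : List V) :
      l ∈ S ↔ l.Nodup ∧ (∀ v, v ∈ l) ∧ l.Pairwise fun a b => ¬ r b a := by
    simp only [S, List.mem_filter, List.mem_permutations, decide_eq_true_eq, ← and_assoc]
    refine and_congr_left fun _ => ⟨fun h => ?_, fun h => ?_⟩
    · exact ⟨h.nodup_iff.2 (Finset.nodup_toList _), fun v => h.mem_iff.2 (by simp)⟩
    · exact (List.perm_ext_iff_of_nodup h.1 (Finset.nodup_toList _)).2 (by simp [h.2])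
  refine ⟨S.flatten, fun v => ?_, fun x y hxy => ?_⟩
  · obtain ⟨l, hl⟩ := exists_list_linearExtension r hr.irrefl htrans
    exact List.mem_flatten.2 ⟨l, (mem_S l).2 hl, hl.2.1 v⟩
  let f : List V → List V := List.filter fun z => decide (z = x ∨ z = y)
  have hf : ∀ l ∈ S, f l = [x, y] ∨ f l = [y, x] := fun l hl =>
    ((mem_S l).1 hl).1.filter_eq_or_eq_pair hxy (((mem_S l).1 hl).2.1 x) (((mem_S l).1 hl).2.1 y)
  have halt : Alternates S.flatten x y ↔
      (∀ l ∈ S, f l = [x, y]) ∨ ∀ l ∈ S, f l = [y, x] := by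
    have := List.isChain_ne_flatten_iff hxy (S.map f) (by simpa using hf)
    simp only [← List.filter_flatten, f, List.forall_mem_map] at this
    exact this
  -- an extension placing `b` before `a` refutes that all restrictions are `[a, b]`
  have hcomp {a b : V} (hab : a ≠ b) (h : ∀ l ∈ S, f l = [a, b]) : r a b := by
    by_contra hnr
    obtain ⟨l, hnd, hmem, hl, hl'⟩ :=
      exists_list_linearExtension_of_incomparable r hr.irrefl htrans hab.symm hnr
    exact hl'.rel_of_filter_eq_pair (h l ((mem_S l).2 ⟨hnd, hmem, hl⟩)) ⟨rfl, rfl⟩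
  rw [halt, hr.adj_iff]
  constructor
  · exact Or.imp (hcomp hxy) (hcomp hxy.symm)
  · refine Or.imp (fun h l hl => (hf l hl).resolve_right fun h' => ?_)
      (fun h l hl => (hf l hl).resolve_left fun h' => ?_)
    all_goals exact ((mem_S l).1 hl).2.2.rel_of_filter_eq_pair h' h

/-- Adding a universal vertex to a comparability graph yields a comparability graph: orient
all new edges away from the new vertex. -/
theorem IsComparabilityGraph.of_universal_vertex {V : Type*} {H : SimpleGraph V}
    (hH : IsComparabilityGraph H) (G : SimpleGraph (Option V))
    (hold : ∀ u v : V, G.Adj (some u) (some v) ↔ H.Adj u v)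
    (hnew : ∀ u : V, G.Adj none (some u)) : IsComparabilityGraph G := by
  obtain ⟨r, hr, htrans⟩ := hH
  refine ⟨fun a b => b.elim False fun v => a.elim True fun u => r u v, ⟨?_, ?_, ?_⟩, ?_⟩
  · rintro (_ | v)
    exacts [id, hr.irrefl v]
  · rintro (_ | u) (_ | v)
    exacts [fun h => h.elim, fun _ => id, fun h => h.elim, hr.asymm u v]
  · rintro (_ | u) (_ | v)
    · simp
    · simp [hnew]
    · simp [(hnew u).symm]
    · simp [hold, hr.adj_iff]
  · rintro (_ | u) (_ | v) (_ | z) <;> simp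
    exact htrans u v z

/-- Adding a universal vertex to a finite comparability graph `H` yields a
word-representable graph. The new graph `G` lives on `Option V`, with `none` the new
universal vertex. -/
theorem stmt17 {V : Type*} [Fintype V] [DecidableEq V] (H : SimpleGraph V)
    (hH : IsComparabilityGraph H) (G : SimpleGraph (Option V))
    (hold : ∀ u v : V, G.Adj (some u) (some v) ↔ H.Adj u v)
    (hnew : ∀ u : V, G.Adj none (some u)) :
    WordRepresentable G := by
  exact (hH.of_universal_vertex G hold hnew).wordRepresentable
end
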